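/- Let H satisfy Assumption (H), let κ be a decreasing L1-kernel which is not identically zero, and let a : [0,∞) → (w_*, w_max] be continuous and increasing. Then the nonlinear integral equation g(t) = H(a(t) + ∫₀^t κ(t−s) g(s) ds), t ≥ 0, has a unique global continuous solution g, given by g(t) = H(f(t)) where f is the unique global continuous solution of f(t) = a(t) + ∫₀^t κ(t−s) H(f(s)) ds, and g(t) < 0 for all t > 0. -/

import Mathlib

open MeasureTheory Set Filter

/-- Assumption (H): `H : (−∞, w_max] → ℝ` (modeled on all of `ℝ`, with all
conditions imposed on `(−∞, w_max]`) is continuously differentiable and convex,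
has a unique root `w_*` in `(−∞, w_max]`, `H′(w_*) < 0` and `H(w_max) < 0`. -/
def AssumptionH (wmax wstar : ℝ) (H : ℝ → ℝ) : Prop :=
  wstar ≤ wmax ∧
  ContDiffOn ℝ 1 H (Set.Iic wmax) ∧
  ConvexOn ℝ (Set.Iic wmax) H ∧
  H wstar = 0 ∧
  (∀ w ∈ Set.Iic wmax, H w = 0 → w = wstar) ∧
  derivWithin H (Set.Iic wmax) wstar < 0 ∧
  H wmax < 0

/-- An `L_p`-kernel: nonnegative on `[0,∞)`, continuous on `(0,∞)`,
with `∫₀^T κ(t)^p dt < ∞` for all `T > 0`. -/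
def IsLpKernel (p : ℝ) (κ : ℝ → ℝ) : Prop :=
  (∀ t, 0 ≤ t → 0 ≤ κ t) ∧ ContinuousOn κ (Set.Ioi 0) ∧
    ∀ T > 0, MeasureTheory.IntegrableOn (fun t => κ t ^ p) (Set.Ioc 0 T)

open Topology

namespace IsLpKernel

variable {κ : ℝ → ℝ}

theorem intervalIntegrable (hκ : IsLpKernel 1 κ) {T : ℝ} (hT : 0 ≤ T) :
    IntervalIntegrable κ volume 0 T := by
  rcases hT.eq_or_lt with rfl | hT
  · exact IntervalIntegrable.refl
  · rw [intervalIntegrable_iff_integrableOn_Ioc_of_le hT.le]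
    simpa only [Real.rpow_one] using hκ.2.2 T hT

theorem intervalIntegrable_sub (hκ : IsLpKernel 1 κ) {c t : ℝ} (ht : c ≤ t) :
    IntervalIntegrable (fun s => κ (t - s)) volume c t := by
  simpa using ((hκ.intervalIntegrable (sub_nonneg.2 ht)).comp_sub_left t).symm

theorem intervalIntegrable_conv (hκ : IsLpKernel 1 κ) {N : ℝ → ℝ} (hN : ContinuousOn N (Ici 0))
    {t : ℝ} (ht : 0 ≤ t) : IntervalIntegrable (fun s => κ (t - s) * N s) volume 0 t := by
  refine (hκ.intervalIntegrable_sub ht).mul_continuousOn (hN.mono ?_)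
  rw [uIcc_of_le ht]
  exact fun s hs => hs.1

/-- The Volterra convolution of an `L₁`-kernel with a continuous function is continuous. -/
theorem continuousOn_conv (hκ : IsLpKernel 1 κ) {N : ℝ → ℝ} (hN : ContinuousOn N (Ici 0)) :
    ContinuousOn (fun t => ∫ s in (0 : ℝ)..t, κ (t - s) * N s) (Ici 0) := by
  intro t₀ ht₀
  rw [mem_Ici] at ht₀
  set T := t₀ + 1 with hT
  have hT0 : 0 ≤ T := by linarith
  set P : ℝ → ℝ := fun s => N (max 0 (min s T)) with hP
  have hPc : Continuous P :=
    hN.comp_continuous (by fun_prop) fun s => mem_Ici.2 (le_max_left _ _)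
  obtain ⟨C, hC⟩ : ∃ C, ∀ s, ‖P s‖ ≤ C := by
    obtain ⟨C, hC⟩ := isCompact_Icc.exists_bound_of_continuousOn
      (hN.mono (Icc_subset_Ici_self : Icc 0 T ⊆ Ici 0))
    exact ⟨C, fun s => hC _ ⟨le_max_left _ _, max_le hT0 (min_le_right _ _)⟩⟩
  set Q : ℝ → ℝ := (Ioi 0).indicator P
  have hQm : Measurable Q := hPc.measurable.indicator measurableSet_Ioi
  have hQC : ∀ s, ‖Q s‖ ≤ C := fun s => (norm_indicator_le_norm_self _ _).trans (hC s)
  have hQcont : ∀ s, s ≠ 0 → ContinuousAt Q s := by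
    intro s hs
    rcases lt_or_gt_of_ne hs with h | h
    · refine (continuousAt_const (y := (0 : ℝ))).congr ?_
      filter_upwards [Iio_mem_nhds h] with x hx
      exact (indicator_of_notMem (notMem_Ioi.2 (le_of_lt hx)) _).symm
    · refine hPc.continuousAt.congr ?_
      filter_upwards [Ioi_mem_nhds h] with x hx
      exact (indicator_of_mem hx _).symm
  have hκT := hκ.intervalIntegrable hT0
  have hmeas : ∀ t, AEStronglyMeasurable (fun u => κ u * Q (t - u))
      (volume.restrict (uIoc 0 T)) := fun t =>
    hκT.def'.aestronglyMeasurable.mul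
      (hQm.comp (measurable_const.sub measurable_id)).aestronglyMeasurable
  have hbd : ∀ t u, ‖κ u * Q (t - u)‖ ≤ ‖κ u‖ * C := fun t u => by
    rw [norm_mul]
    exact mul_le_mul_of_nonneg_left (hQC _) (norm_nonneg _)
  have hcont : ContinuousAt (fun t => ∫ u in (0 : ℝ)..T, κ u * Q (t - u)) t₀ := by
    refine intervalIntegral.continuousAt_of_dominated_interval (bound := fun u => ‖κ u‖ * C)
      (.of_forall hmeas) (.of_forall fun t => .of_forall fun u _ => hbd t u)
      (hκT.norm.mul_const C) ?_
    have : ∀ᵐ u : ℝ, u ≠ t₀ := by simp [ae_iff]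
    filter_upwards [this] with u hu _
    have h1 := hQcont (t₀ - u) (sub_ne_zero.2 hu.symm)
    have h2 : ContinuousAt (fun t : ℝ => t - u) t₀ := by fun_prop
    exact continuousAt_const.mul (ContinuousAt.comp (f := fun t : ℝ => t - u) h1 h2)
  refine hcont.continuousWithinAt.congr_of_eventuallyEq_of_mem ?_ ht₀
  have hTn : Iic T ∈ 𝓝[Ici 0] t₀ := mem_nhdsWithin_of_mem_nhds (Iic_mem_nhds (by linarith))
  filter_upwards [self_mem_nhdsWithin, hTn] with t ht htT
  rw [mem_Ici] at ht
  rw [mem_Iic] at htT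
  have hint : IntervalIntegrable (fun u => κ u * Q (t - u)) volume 0 T :=
    (hκT.norm.mul_const C).mono_fun' (hmeas t) (.of_forall (hbd t))
  have hs1 : uIcc 0 t ⊆ uIcc 0 T := by
    rw [uIcc_of_le ht, uIcc_of_le hT0]; exact Icc_subset_Icc le_rfl htT
  have hs2 : uIcc t T ⊆ uIcc 0 T := by
    rw [uIcc_of_le htT, uIcc_of_le hT0]; exact Icc_subset_Icc ht le_rfl
  rw [← intervalIntegral.integral_add_adjacent_intervals (hint.mono_set hs1) (hint.mono_set hs2)]
  have hz : ∫ u in t..T, κ u * Q (t - u) = 0 := by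
    rw [intervalIntegral.integral_congr (g := fun _ => (0 : ℝ)), intervalIntegral.integral_zero]
    intro u hu
    rw [uIcc_of_le htT] at hu
    have : Q (t - u) = 0 := indicator_of_notMem (notMem_Ioi.2 (by linarith [hu.1])) _
    simp [this]
  have hflip := intervalIntegral.integral_comp_sub_left (a := 0) (b := t)
    (fun u => κ u * Q (t - u)) t
  simp only [sub_sub_cancel, sub_self, sub_zero] at hflip
  rw [hz, add_zero, ← hflip, intervalIntegral.integral_of_le ht, intervalIntegral.integral_of_le ht]
  refine setIntegral_congr_fun measurableSet_Ioc fun s hs => ?_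
  have h1 : Q s = P s := indicator_of_mem hs.1 _
  have h2 : P s = N s := by
    simp only [hP, min_eq_left (hs.2.trans htT), max_eq_right hs.1.le]
  simp only [h1, h2]

theorem integrableOn_exp_mul (hκ : IsLpKernel 1 κ) (hdec : AntitoneOn κ (Ioi 0)) :
    IntegrableOn (fun u => Real.exp (-u) * κ u) (Ioi 0) := by
  rw [← Ioc_union_Ioi_eq_Ioi zero_le_one]
  refine IntegrableOn.union ?_ ?_
  · have h := (hκ.intervalIntegrable zero_le_one).continuousOn_mul
      (by fun_prop : ContinuousOn (fun u : ℝ => Real.exp (-u)) (uIcc 0 1))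
    rwa [intervalIntegrable_iff_integrableOn_Ioc_of_le zero_le_one] at h
  · have h := (integrableOn_exp_neg_Ioi 1).mul_const (κ 1)
    refine Integrable.mono' h ?_ ?_
    · refine ContinuousOn.aestronglyMeasurable ?_ measurableSet_Ioi
      exact (by fun_prop : ContinuousOn (fun u : ℝ => Real.exp (-u)) _).mul
        (hκ.2.1.mono (Ioi_subset_Ioi zero_le_one))
    · filter_upwards [ae_restrict_mem measurableSet_Ioi] with u hu
      have hu0 : (0 : ℝ) < u := zero_lt_one.trans hu
      rw [Real.norm_of_nonneg (mul_nonneg (Real.exp_nonneg _) (hκ.1 u hu0.le))]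
      exact mul_le_mul_of_nonneg_left
        (hdec (mem_Ioi.2 zero_lt_one) hu0 (le_of_lt hu)) (Real.exp_nonneg _)

/-- The Laplace transform of a decreasing kernel is arbitrarily small at large arguments. -/
theorem exists_laplace_lt (hκ : IsLpKernel 1 κ) (hdec : AntitoneOn κ (Ioi 0)) {q : ℝ}
    (hq : 0 < q) : ∃ σ : ℝ, 0 ≤ σ ∧ IntegrableOn (fun u => Real.exp (-(σ * u)) * κ u) (Ioi 0) ∧
      ∫ u in Ioi 0, Real.exp (-(σ * u)) * κ u < q := by
  have hm : ∀ n : ℕ, AEStronglyMeasurable (fun u => Real.exp (-(((n : ℝ) + 1) * u)) * κ u)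
      (volume.restrict (Ioi 0)) := fun n =>
    (ContinuousOn.mul (by fun_prop) hκ.2.1).aestronglyMeasurable measurableSet_Ioi
  have hb : ∀ n : ℕ, ∀ᵐ u ∂(volume.restrict (Ioi 0)),
      ‖Real.exp (-(((n : ℝ) + 1) * u)) * κ u‖ ≤ Real.exp (-u) * κ u := by
    intro n
    filter_upwards [ae_restrict_mem measurableSet_Ioi] with u hu
    rw [mem_Ioi] at hu
    rw [Real.norm_of_nonneg (mul_nonneg (Real.exp_nonneg _) (hκ.1 u hu.le))]
    refine mul_le_mul_of_nonneg_right (Real.exp_le_exp.2 ?_) (hκ.1 u hu.le)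
    have : 0 ≤ (n : ℝ) * u := by positivity
    linarith
  have hI := hκ.integrableOn_exp_mul hdec
  have hlim := tendsto_integral_of_dominated_convergence (f := fun _ => (0 : ℝ)) _ hm hI hb (by
    filter_upwards [ae_restrict_mem measurableSet_Ioi] with u hu
    rw [mem_Ioi] at hu
    rw [← zero_mul (κ u)]
    refine Tendsto.mul_const _ (Real.tendsto_exp_neg_atTop_nhds_zero.comp ?_)
    exact (tendsto_atTop_add_const_right _ _ tendsto_natCast_atTop_atTop).atTop_mul_const hu)
  rw [integral_zero] at hlim
  obtain ⟨n, hn⟩ := (hlim.eventually_lt_const hq).exists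
  exact ⟨n + 1, by positivity, Integrable.mono' hI (hm n) (hb n), hn⟩

theorem abs_conv_le_of_exp_bound (hκ : IsLpKernel 1 κ) {σ : ℝ}
    (hσ : IntegrableOn (fun u => Real.exp (-(σ * u)) * κ u) (Ioi 0)) {φ : ℝ → ℝ} {t M : ℝ}
    (ht : 0 ≤ t) (hM : 0 ≤ M) (hφ : ∀ s ∈ Ioc 0 t, |φ s| ≤ M * Real.exp (σ * s)) :
    |∫ s in (0 : ℝ)..t, κ (t - s) * φ s| ≤
      M * Real.exp (σ * t) * ∫ u in Ioi 0, Real.exp (-(σ * u)) * κ u := by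
  set k : ℝ → ℝ := fun u => Real.exp (-(σ * u)) * κ u with hk
  have hkt : IntervalIntegrable k volume 0 t := by
    rw [intervalIntegrable_iff_integrableOn_Ioc_of_le ht]
    exact hσ.mono_set Ioc_subset_Ioi_self
  have hkt' : IntervalIntegrable (fun s => k (t - s)) volume 0 t := by
    simpa using (hkt.comp_sub_left t).symm
  have hflip : ∫ s in (0 : ℝ)..t, k (t - s) = ∫ u in (0 : ℝ)..t, k u := by
    simp [intervalIntegral.integral_comp_sub_left (fun u => k u)]
  have hle : ∫ u in (0 : ℝ)..t, k u ≤ ∫ u in Ioi 0, k u := by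
    rw [intervalIntegral.integral_of_le ht]
    refine setIntegral_mono_set hσ ?_ Ioc_subset_Ioi_self.eventuallyLE
    filter_upwards [ae_restrict_mem measurableSet_Ioi] with u hu
    exact mul_nonneg (Real.exp_nonneg _) (hκ.1 u (le_of_lt hu))
  have hmain := intervalIntegral.norm_integral_le_of_norm_le (μ := volume)
    (f := fun s => κ (t - s) * φ s) ht
    (g := fun s => M * Real.exp (σ * t) * k (t - s)) (.of_forall fun s hs => by
      have h0 : 0 ≤ κ (t - s) := hκ.1 _ (sub_nonneg.2 hs.2)
      rw [norm_mul, Real.norm_of_nonneg h0, Real.norm_eq_abs]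
      calc κ (t - s) * |φ s| ≤ κ (t - s) * (M * Real.exp (σ * s)) :=
            mul_le_mul_of_nonneg_left (hφ s hs) h0
        _ = M * Real.exp (σ * t) * k (t - s) := by
            have : Real.exp (σ * s) = Real.exp (σ * t) * Real.exp (-(σ * (t - s))) := by
              rw [← Real.exp_add]; congr 1; ring
            rw [this, hk]; ring) (hkt'.const_mul _)
  rw [intervalIntegral.integral_const_mul, hflip, Real.norm_eq_abs] at hmain
  exact hmain.trans (mul_le_mul_of_nonneg_left hle (by positivity))

/-- A homogeneous linear Volterra inequality has only the zero solution. -/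
theorem eq_zero_of_abs_le_conv (hκ : IsLpKernel 1 κ) (hdec : AntitoneOn κ (Ioi 0))
    {d φ : ℝ → ℝ} {L T : ℝ} (hT : 0 ≤ T) (hL : 0 ≤ L) (hd : ContinuousOn d (Icc 0 T))
    (hφ : ∀ s ∈ Icc 0 T, |φ s| ≤ L * |d s|)
    (heq : ∀ t ∈ Icc 0 T, d t = ∫ s in (0 : ℝ)..t, κ (t - s) * φ s) :
    ∀ t ∈ Icc 0 T, d t = 0 := by
  obtain ⟨σ, -, hσ, hq⟩ := hκ.exists_laplace_lt hdec (q := 1 / (L + 1)) (by positivity)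
  obtain ⟨t₀, ht₀, hmax⟩ := isCompact_Icc.exists_isMaxOn (nonempty_Icc.2 hT)
    (f := fun t => Real.exp (-(σ * t)) * |d t|)
    (ContinuousOn.mul (by fun_prop) hd.abs)
  set m := Real.exp (-(σ * t₀)) * |d t₀| with hm
  have hm0 : 0 ≤ m := by positivity
  have hdm : ∀ s ∈ Icc 0 T, |d s| ≤ m * Real.exp (σ * s) := fun s hs => by
    have h : Real.exp (-(σ * s)) * |d s| ≤ m := hmax hs
    rwa [Real.exp_neg, inv_mul_le_iff₀ (Real.exp_pos _), mul_comm] at h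
  have h := hκ.abs_conv_le_of_exp_bound hσ (φ := φ) ht₀.1 (mul_nonneg hL hm0) fun s hs => by
    have hs' : s ∈ Icc 0 T := ⟨hs.1.le, hs.2.trans ht₀.2⟩
    rw [mul_assoc]
    exact (hφ s hs').trans (mul_le_mul_of_nonneg_left (hdm s hs') hL)
  rw [← heq t₀ ht₀] at h
  set I := ∫ u in Ioi 0, Real.exp (-(σ * u)) * κ u
  have hmI : m ≤ L * m * I := by
    have h1 := mul_le_mul_of_nonneg_left h (Real.exp_nonneg (-(σ * t₀)))
    have h2 : Real.exp (-(σ * t₀)) * Real.exp (σ * t₀) = 1 := by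
      rw [← Real.exp_add, neg_add_cancel, Real.exp_zero]
    calc m ≤ Real.exp (-(σ * t₀)) * (L * m * Real.exp (σ * t₀) * I) := h1
      _ = Real.exp (-(σ * t₀)) * Real.exp (σ * t₀) * (L * m * I) := by ring
      _ = L * m * I := by rw [h2, one_mul]
  have hLI : L * m * I ≤ L * m * (1 / (L + 1)) :=
    mul_le_mul_of_nonneg_left hq.le (mul_nonneg hL hm0)
  have hmz : m ≤ 0 := by
    have := hmI.trans hLI
    rw [mul_one_div, le_div_iff₀ (by positivity)] at this
    linarith
  intro t ht
  have := hdm t ht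
  rw [le_antisymm hmz hm0, zero_mul] at this
  exact abs_nonpos_iff.1 this

/-- Global solvability of the Volterra equation with bounded data and bounded Lipschitz
nonlinearity, by contraction in an exponentially weighted supremum norm. -/
theorem exists_solution_of_lipschitz (hκ : IsLpKernel 1 κ) (hdec : AntitoneOn κ (Ioi 0))
    {a K : ℝ → ℝ} {L : NNReal} {A C : ℝ} (ha : ContinuousOn a (Ici 0))
    (haA : ∀ t, 0 ≤ t → |a t| ≤ A) (hK : LipschitzWith L K) (hKC : ∀ x, |K x| ≤ C) :
    ∃ f : ℝ → ℝ, ContinuousOn f (Ici 0) ∧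
      ∀ t, 0 ≤ t → f t = a t + ∫ s in (0 : ℝ)..t, κ (t - s) * K (f s) := by
  obtain ⟨σ, hσ0, hσ, hq⟩ := hκ.exists_laplace_lt hdec (q := 1 / ((L : ℝ) + 1)) (by positivity)
  set I := ∫ u in Ioi 0, Real.exp (-(σ * u)) * κ u with hI
  have hI0 : 0 ≤ I := setIntegral_nonneg measurableSet_Ioi fun u hu =>
    mul_nonneg (Real.exp_nonneg _) (hκ.1 u (le_of_lt hu))
  have hC0 : 0 ≤ C := (abs_nonneg _).trans (hKC 0)
  have hN : ∀ h : BoundedContinuousFunction ℝ ℝ,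
      ContinuousOn (fun s => K (Real.exp (σ * s) * h s)) (Ici 0) := fun h =>
    (hK.continuous.comp (by fun_prop)).continuousOn
  set W : BoundedContinuousFunction ℝ ℝ → ℝ → ℝ := fun h t =>
    Real.exp (-(σ * t)) * (a t + ∫ s in (0 : ℝ)..t, κ (t - s) * K (Real.exp (σ * s) * h s))
    with hW
  have hWc : ∀ h, Continuous fun t => W h (max 0 t) := fun h =>
    ((by fun_prop : ContinuousOn (fun t : ℝ => Real.exp (-(σ * t))) (Ici 0)).mul
      (ha.add (hκ.continuousOn_conv (hN h)))).comp_continuous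
      (continuous_const.max continuous_id) fun t => mem_Ici.2 (le_max_left 0 t)
  have hWb : ∀ h t, ‖W h (max 0 t)‖ ≤ A + C * I := by
    intro h t
    have ht : 0 ≤ max 0 t := le_max_left _ _
    generalize max 0 t = t at ht
    have h1 := hκ.abs_conv_le_of_exp_bound hσ (φ := fun s => K (Real.exp (σ * s) * h s)) ht hC0
      fun s hs => (hKC _).trans (le_mul_of_one_le_right hC0
        (Real.one_le_exp (mul_nonneg hσ0 hs.1.le)))
    rw [← hI] at h1
    have hE : 1 ≤ Real.exp (σ * t) := Real.one_le_exp (mul_nonneg hσ0 ht)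
    rw [hW, norm_mul, Real.norm_of_nonneg (Real.exp_nonneg _), Real.exp_neg,
      inv_mul_le_iff₀ (Real.exp_pos _), Real.norm_eq_abs]
    have hA0 : 0 ≤ A := (abs_nonneg _).trans (haA t ht)
    calc |a t + ∫ s in (0 : ℝ)..t, κ (t - s) * K (Real.exp (σ * s) * h s)|
        ≤ A + C * Real.exp (σ * t) * I := (abs_add_le _ _).trans (add_le_add (haA t ht) h1)
      _ ≤ Real.exp (σ * t) * (A + C * I) := by
          have := mul_le_mul_of_nonneg_right hE hA0
          linarith
  set Φ : BoundedContinuousFunction ℝ ℝ → BoundedContinuousFunction ℝ ℝ := fun h =>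
    BoundedContinuousFunction.ofNormedAddCommGroup (fun t => W h (max 0 t)) (hWc h) _ (hWb h)
  have hlt : (L : ℝ) * I < 1 := by
    calc (L : ℝ) * I ≤ L * (1 / (L + 1)) := mul_le_mul_of_nonneg_left hq.le L.2
      _ < 1 := by
        rw [mul_one_div, div_lt_one (by positivity)]
        linarith
  have hcontr : ContractingWith ⟨L * I, mul_nonneg L.2 hI0⟩ Φ := by
    refine ⟨by exact_mod_cast hlt, LipschitzWith.of_dist_le_mul fun h₁ h₂ => ?_⟩
    refine (BoundedContinuousFunction.dist_le
      (mul_nonneg (mul_nonneg L.2 hI0) dist_nonneg)).2 fun t => ?_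
    change dist (W h₁ (max 0 t)) (W h₂ (max 0 t)) ≤ L * I * dist h₁ h₂
    have ht : 0 ≤ max 0 t := le_max_left _ _
    generalize max 0 t = t at ht
    have h1 := hκ.abs_conv_le_of_exp_bound hσ ht (M := L * dist h₁ h₂)
      (φ := fun s => K (Real.exp (σ * s) * h₁ s) - K (Real.exp (σ * s) * h₂ s))
      (mul_nonneg L.2 dist_nonneg) fun s _ => by
        have h2 := hK.dist_le_mul (Real.exp (σ * s) * h₁ s) (Real.exp (σ * s) * h₂ s)
        rw [Real.dist_eq, Real.dist_eq, ← mul_sub, abs_mul, abs_of_pos (Real.exp_pos _)] at h2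
        have h3 : |h₁ s - h₂ s| ≤ dist h₁ h₂ := by
          simpa only [Real.dist_eq] using
            BoundedContinuousFunction.dist_coe_le_dist (f := h₁) (g := h₂) s
        calc _ ≤ (L : ℝ) * (Real.exp (σ * s) * |h₁ s - h₂ s|) := h2
          _ ≤ (L : ℝ) * (Real.exp (σ * s) * dist h₁ h₂) := by gcongr
          _ = _ := by ring
    simp only [mul_sub] at h1
    rw [intervalIntegral.integral_sub (hκ.intervalIntegrable_conv (hN h₁) ht)
      (hκ.intervalIntegrable_conv (hN h₂) ht), ← hI] at h1
    rw [hW, Real.dist_eq, ← mul_sub, abs_mul, abs_of_pos (Real.exp_pos _), Real.exp_neg,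
      inv_mul_le_iff₀ (Real.exp_pos _), add_sub_add_left_eq_sub]
    linarith
  set h := hcontr.fixedPoint
  have hfix : Φ h = h := hcontr.fixedPoint_isFixedPt
  refine ⟨fun t => Real.exp (σ * t) * h t, by fun_prop, fun t ht => ?_⟩
  have h1 : h t = W h t := by
    have h2 : Φ h t = W h (max 0 t) := rfl
    rw [hfix, max_eq_right ht] at h2
    exact h2
  change Real.exp (σ * t) * h t = _
  rw [h1, hW, ← mul_assoc, ← Real.exp_add, add_neg_cancel, Real.exp_zero, one_mul]

/-- Solutions of a Volterra equation with a locally Lipschitz nonlinearity are unique. -/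
theorem eqOn_of_solutions (hκ : IsLpKernel 1 κ) (hdec : AntitoneOn κ (Ioi 0)) {a H : ℝ → ℝ}
    {b : ℝ} (hH : ContinuousOn H (Iic b)) (hlip : ∀ m, ∃ L, LipschitzOnWith L H (Icc m b))
    {f₁ f₂ : ℝ → ℝ}
    (hc₁ : ContinuousOn f₁ (Ici 0)) (hb₁ : ∀ t, 0 ≤ t → f₁ t ≤ b)
    (he₁ : ∀ t, 0 ≤ t → f₁ t = a t + ∫ s in (0 : ℝ)..t, κ (t - s) * H (f₁ s))
    (hc₂ : ContinuousOn f₂ (Ici 0)) (hb₂ : ∀ t, 0 ≤ t → f₂ t ≤ b)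
    (he₂ : ∀ t, 0 ≤ t → f₂ t = a t + ∫ s in (0 : ℝ)..t, κ (t - s) * H (f₂ s)) :
    ∀ t, 0 ≤ t → f₁ t = f₂ t := by
  intro T hT
  have hsub : Icc 0 T ⊆ Ici 0 := Icc_subset_Ici_self
  obtain ⟨m₁, hm₁⟩ := isCompact_Icc.bddBelow_image (hc₁.mono hsub)
  obtain ⟨m₂, hm₂⟩ := isCompact_Icc.bddBelow_image (hc₂.mono hsub)
  obtain ⟨L, hL⟩ := hlip (min m₁ m₂)
  refine sub_eq_zero.1 (hκ.eq_zero_of_abs_le_conv hdec (d := fun t => f₁ t - f₂ t)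
    (φ := fun t => H (f₁ t) - H (f₂ t)) hT L.2 ((hc₁.mono hsub).sub (hc₂.mono hsub))
    (fun s hs => ?_) (fun t ht => ?_) T ⟨hT, le_rfl⟩)
  · exact hL.dist_le_mul _ ⟨(min_le_left _ _).trans (hm₁ (mem_image_of_mem _ hs)), hb₁ s hs.1⟩
      _ ⟨(min_le_right _ _).trans (hm₂ (mem_image_of_mem _ hs)), hb₂ s hs.1⟩
  · have hi₁ := hκ.intervalIntegrable_conv (hH.comp hc₁ hb₁) ht.1
    have hi₂ := hκ.intervalIntegrable_conv (hH.comp hc₂ hb₂) ht.1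
    simp only [mul_sub]
    have := intervalIntegral.integral_sub hi₁ hi₂
    simp only [Function.comp_apply] at this
    rw [this]
    linarith [he₁ t ht.1, he₂ t ht.1]

/-- A solution driven by an increasing `a > b` stays above the zero `b` of a nonpositive
nonlinearity. -/
theorem lt_of_solution (hκ : IsLpKernel 1 κ) (hdec : AntitoneOn κ (Ioi 0)) {a K f : ℝ → ℝ}
    {b L : ℝ} (hL : 0 ≤ L) (hKc : Continuous K) (hK0 : ∀ x, K x ≤ 0)
    (hKL : ∀ x, -K x ≤ L * max (x - b) 0)
    (hamono : MonotoneOn a (Ici 0)) (hab : ∀ t, 0 ≤ t → b < a t) (hf : ContinuousOn f (Ici 0))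
    (heq : ∀ t, 0 ≤ t → f t = a t + ∫ s in (0 : ℝ)..t, κ (t - s) * K (f s)) :
    ∀ t, 0 ≤ t → b < f t := by
  by_contra! hcon
  obtain ⟨r, hr0, hr⟩ := hcon
  have hclosed : IsClosed (Ici (0 : ℝ) ∩ f ⁻¹' Iic b) :=
    hf.preimage_isClosed_of_isClosed isClosed_Ici isClosed_Iic
  have hbdd : BddBelow (Ici (0 : ℝ) ∩ f ⁻¹' Iic b) := ⟨0, fun x hx => hx.1⟩
  obtain ⟨ht0, hft⟩ := hclosed.csInf_mem ⟨r, hr0, hr⟩ hbdd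
  set t₀ := sInf (Ici (0 : ℝ) ∩ f ⁻¹' Iic b)
  rw [mem_Ici] at ht0
  replace hft : f t₀ ≤ b := hft
  have hbefore : ∀ s, 0 ≤ s → s < t₀ → b < f s := fun s hs hst => by
    by_contra! h
    exact absurd (csInf_le hbdd ⟨hs, h⟩) (not_le.2 hst)
  have hpos : 0 < t₀ := by
    refine ht0.lt_of_ne fun h => ?_
    have h0 := heq 0 le_rfl
    rw [intervalIntegral.integral_same, add_zero] at h0
    rw [← h, h0] at hft
    exact absurd (hab 0 le_rfl) (not_lt.2 hft)
  obtain ⟨δ, hδ0, hδ⟩ : ∃ δ > 0, ∀ u, 0 ≤ u → u < δ →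
      ∫ s in (0 : ℝ)..u, κ (u - s) < 1 / (L + 1) := by
    have hc := hκ.continuousOn_conv (N := fun _ => 1) continuousOn_const 0 self_mem_Ici
    simp only [mul_one] at hc
    have h1 : ∀ᶠ u in 𝓝[≥] (0 : ℝ), ∫ s in (0 : ℝ)..u, κ (u - s) < 1 / (L + 1) :=
      hc.eventually_lt_const (by simp; positivity)
    obtain ⟨δ, hδ0, hδ⟩ := mem_nhdsGE_iff_exists_Ico_subset.1 h1
    exact ⟨δ, hδ0, fun u hu huδ => hδ ⟨hu, huδ⟩⟩
  set t₁ := max 0 (t₀ - δ / 2)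
  have ht10 : 0 ≤ t₁ := le_max_left _ _
  have ht1t : t₁ < t₀ := max_lt hpos (by linarith)
  obtain ⟨p, hp, hmax⟩ := isCompact_Icc.exists_isMaxOn (nonempty_Icc.2 ht1t.le)
    (hf.mono fun s (hs : s ∈ Icc t₁ t₀) => ht10.trans hs.1)
  set M := f p - b with hM
  have hM0 : 0 < M := by
    have h1 : f t₁ ≤ f p := hmax ⟨le_rfl, ht1t.le⟩
    linarith [hbefore t₁ ht10 ht1t]
  have hpt : p < t₀ := hp.2.lt_of_ne fun h => by
    rw [hM, h] at hM0
    linarith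
  have hp0 : 0 ≤ p := ht10.trans hp.1
  have hN : ContinuousOn (fun s => K (f s)) (Ici 0) := hKc.comp_continuousOn hf
  have hit := hκ.intervalIntegrable_conv hN ht0
  have hip := hκ.intervalIntegrable_conv hN hp0
  have hs1 : uIcc 0 p ⊆ uIcc 0 t₀ := by
    rw [uIcc_of_le hp0, uIcc_of_le ht0]; exact Icc_subset_Icc le_rfl hpt.le
  have hs2 : uIcc p t₀ ⊆ uIcc 0 t₀ := by
    rw [uIcc_of_le hpt.le, uIcc_of_le ht0]; exact Icc_subset_Icc hp0 le_rfl
  have hsplit := intervalIntegral.integral_add_adjacent_intervals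
    (hit.mono_set hs1) (hit.mono_set hs2)
  have hcmp : ∫ s in (0 : ℝ)..p, κ (p - s) * K (f s) ≤
      ∫ s in (0 : ℝ)..p, κ (t₀ - s) * K (f s) :=
    intervalIntegral.integral_mono_on_of_le_Ioo hp0 hip (hit.mono_set hs1) fun s hs =>
      mul_le_mul_of_nonpos_right (hdec (mem_Ioi.2 (by linarith [hs.2]))
        (mem_Ioi.2 (by linarith [hs.2])) (by linarith)) (hK0 _)
  have hlow : ∫ s in p..t₀, κ (t₀ - s) * (-(L * M)) ≤ ∫ s in p..t₀, κ (t₀ - s) * K (f s) :=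
    intervalIntegral.integral_mono_on_of_le_Ioo hpt.le
      ((hκ.intervalIntegrable_sub hpt.le).mul_const _) (hit.mono_set hs2) fun s hs => by
      refine mul_le_mul_of_nonneg_left ?_ (hκ.1 _ (by linarith [hs.2]))
      have h1 : f s ≤ f p := hmax ⟨hp.1.trans hs.1.le, hs.2.le⟩
      have h2 : L * max (f s - b) 0 ≤ L * M :=
        mul_le_mul_of_nonneg_left (max_le (by linarith) hM0.le) hL
      linarith [hKL (f s)]
  rw [intervalIntegral.integral_mul_const] at hlow
  have hsmall : ∫ s in p..t₀, κ (t₀ - s) < 1 / (L + 1) := by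
    have h1 := hδ (t₀ - p) (by linarith) (by
      have := le_max_right 0 (t₀ - δ / 2)
      have := hp.1
      linarith)
    rw [intervalIntegral.integral_comp_sub_left (fun u => κ u)] at h1 ⊢
    simpa using h1
  have hLM : (∫ s in p..t₀, κ (t₀ - s)) * (L * M) ≤ 1 / (L + 1) * (L * M) :=
    mul_le_mul_of_nonneg_right hsmall.le (by positivity)
  have hlt : 1 / (L + 1) * (L * M) < M := by
    rw [one_div, inv_mul_lt_iff₀ (by positivity)]
    linarith
  linarith [heq t₀ ht0, heq p hp0, hamono hp0 ht0 hpt.le]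

end IsLpKernel

namespace AssumptionH

variable {wmax wstar : ℝ} {H : ℝ → ℝ}

theorem exists_lipschitzOnWith (hH : AssumptionH wmax wstar H) (m : ℝ) :
    ∃ L, LipschitzOnWith L H (Icc m wmax) := by
  have hd : ContinuousOn (derivWithin H (Iic wmax)) (Iic wmax) :=
    hH.2.1.continuousOn_derivWithin (uniqueDiffOn_Iic _) le_rfl
  obtain ⟨C, hC⟩ := isCompact_Icc.exists_bound_of_continuousOn
    (hd.mono (Icc_subset_Iic_self : Icc m wmax ⊆ _))
  refine ⟨C.toNNReal, (convex_Icc m wmax).lipschitzOnWith_of_nnnorm_hasDerivWithin_le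
    (f' := derivWithin H (Iic wmax)) (fun x hx => ?_) fun x hx => ?_⟩
  · exact ((hH.2.1.differentiableOn one_ne_zero x hx.2).hasDerivWithinAt).mono Icc_subset_Iic_self
  · rw [← norm_toNNReal]
    exact Real.toNNReal_le_toNNReal (hC x hx)

theorem neg_of_mem_Ioc (hH : AssumptionH wmax wstar H) {x : ℝ} (hx : x ∈ Ioc wstar wmax) :
    H x < 0 := by
  obtain ⟨hle, -, hconv, hroot, huniq, -, hneg⟩ := hH
  have h1 : H x ≤ 0 := by
    have := hconv.le_on_segment (mem_Iic.2 hle) self_mem_Iic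
      (z := x) (by rw [segment_eq_Icc hle]; exact Ioc_subset_Icc_self hx)
    rwa [hroot, max_eq_left hneg.le] at this
  exact h1.lt_of_ne fun h => hx.1.ne' (huniq x hx.2 h)

end AssumptionH

/-- Corollary (case (a')): for a continuous increasing `a : [0,∞) → (w_*, w_max]`,
the equation `g(t) = H(a(t) + ∫₀^t κ(t−s) g(s) ds)` has a unique global continuous
solution, given by `g = H ∘ f` for the unique global continuous solution `f` of
`f(t) = a(t) + ∫₀^t κ(t−s) H(f(s)) ds`, and `g(t) < 0` for all `t > 0`. -/
theorem corollary_volterra_case_a'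
    (wmax wstar : ℝ) (H : ℝ → ℝ) (hH : AssumptionH wmax wstar H)
    (κ : ℝ → ℝ) (hκ : IsLpKernel 1 κ) (hdec : AntitoneOn κ (Set.Ioi 0))
    (hne : ∃ t > 0, κ t ≠ 0)
    (a : ℝ → ℝ) (hacont : ContinuousOn a (Set.Ici 0))
    (hamono : MonotoneOn a (Set.Ici 0))
    (haval : ∀ t ≥ 0, a t ∈ Set.Ioc wstar wmax) :
    ∃ f g : ℝ → ℝ,
      (ContinuousOn f (Set.Ici 0) ∧ (∀ t ≥ 0, f t ≤ wmax) ∧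
        (∀ t ≥ 0, f t = a t + ∫ s in (0:ℝ)..t, κ (t - s) * H (f s))) ∧
      (∀ f' : ℝ → ℝ,
        (ContinuousOn f' (Set.Ici 0) ∧ (∀ t ≥ 0, f' t ≤ wmax) ∧
          (∀ t ≥ 0, f' t = a t + ∫ s in (0:ℝ)..t, κ (t - s) * H (f' s))) →
        ∀ t ≥ 0, f' t = f t) ∧
      (∀ t ≥ 0, g t = H (f t)) ∧
      (ContinuousOn g (Set.Ici 0) ∧
        (∀ t ≥ 0, a t + (∫ s in (0:ℝ)..t, κ (t - s) * g s) ≤ wmax ∧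
          g t = H (a t + ∫ s in (0:ℝ)..t, κ (t - s) * g s))) ∧
      (∀ g' : ℝ → ℝ,
        (ContinuousOn g' (Set.Ici 0) ∧
          (∀ t ≥ 0, a t + (∫ s in (0:ℝ)..t, κ (t - s) * g' s) ≤ wmax ∧
            g' t = H (a t + ∫ s in (0:ℝ)..t, κ (t - s) * g' s))) →
        ∀ t ≥ 0, g' t = g t) ∧
      (∀ t > 0, g t < 0) := by
  obtain ⟨L, hL⟩ := hH.exists_lipschitzOnWith wstar
  have hle : wstar ≤ wmax := hH.1
  have hHc : ContinuousOn H (Iic wmax) := hH.2.1.continuousOn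
  have hroot : H wstar = 0 := hH.2.2.2.1
  set K : ℝ → ℝ := fun x => H (projIcc wstar wmax hle x) with hK
  have hKlip : LipschitzWith L K := by
    have h := hL.to_restrict.comp (LipschitzWith.projIcc hle)
    rw [mul_one] at h
    exact h
  have hK0 : ∀ x, K x ≤ 0 := fun x => by
    rcases (projIcc wstar wmax hle x).2.1.eq_or_lt with h | h
    · simp only [hK, ← h, hroot, le_refl]
    · exact (hH.neg_of_mem_Ioc ⟨h, (projIcc wstar wmax hle x).2.2⟩).le
  have hKeq : ∀ x ∈ Icc wstar wmax, K x = H x := fun x hx => by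
    simp only [hK, projIcc_of_mem hle hx]
  have hKL : ∀ x, -K x ≤ L * max (x - wstar) 0 := fun x => by
    rcases le_total x wstar with h | h
    · simp [hK, projIcc_of_le_left hle h, hroot, h]
    · have h1 := hKlip.dist_le_mul x wstar
      rw [hKeq wstar ⟨le_rfl, hle⟩, hroot, Real.dist_eq, Real.dist_eq, sub_zero,
        abs_of_nonneg (sub_nonneg.2 h)] at h1
      rw [max_eq_left (sub_nonneg.2 h)]
      exact (neg_le_abs _).trans h1
  obtain ⟨C, hC⟩ := isCompact_Icc.exists_bound_of_continuousOn
    (hHc.mono (Icc_subset_Iic_self : Icc wstar wmax ⊆ _))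
  obtain ⟨f, hf, hfeq⟩ := hκ.exists_solution_of_lipschitz hdec hacont (A := max |wstar| |wmax|)
    (fun t ht => abs_le_max_abs_abs (haval t ht).1.le (haval t ht).2) hKlip
    (fun x => hC _ (projIcc wstar wmax hle x).2)
  have hlow := hκ.lt_of_solution hdec L.2 hKlip.continuous hK0 hKL hamono
    (fun t ht => (haval t ht).1) hf hfeq
  have hup : ∀ t ≥ 0, f t ≤ wmax := fun t ht => by
    have h1 : ∫ s in (0 : ℝ)..t, κ (t - s) * K (f s) ≤ 0 := by
      have := intervalIntegral.integral_nonneg (μ := volume) ht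
        (f := fun s => -(κ (t - s) * K (f s))) fun s hs =>
          neg_nonneg.2 (mul_nonpos_of_nonneg_of_nonpos (hκ.1 _ (sub_nonneg.2 hs.2)) (hK0 _))
      rw [intervalIntegral.integral_neg] at this
      linarith
    linarith [hfeq t ht, (haval t ht).2]
  have hfH : ∀ t ≥ 0, f t = a t + ∫ s in (0 : ℝ)..t, κ (t - s) * H (f s) := fun t ht => by
    rw [hfeq t ht]
    congr 1
    refine intervalIntegral.integral_congr fun s hs => ?_
    rw [uIcc_of_le ht] at hs
    simp only [hKeq (f s) ⟨(hlow s hs.1).le, hup s hs.1⟩]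
  have huniq : ∀ f' : ℝ → ℝ, (ContinuousOn f' (Ici 0) ∧ (∀ t ≥ 0, f' t ≤ wmax) ∧
      (∀ t ≥ 0, f' t = a t + ∫ s in (0 : ℝ)..t, κ (t - s) * H (f' s))) →
      ∀ t ≥ 0, f' t = f t := fun f' hf' =>
    hκ.eqOn_of_solutions hdec hHc hH.exists_lipschitzOnWith hf'.1 hf'.2.1 hf'.2.2 hf hup hfH
  refine ⟨f, fun t => H (f t), ⟨hf, hup, hfH⟩, huniq, fun _ _ => rfl,
    ⟨hHc.comp hf hup, fun t ht => ?_⟩, fun g' hg' => ?_, fun t ht =>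
    hH.neg_of_mem_Ioc ⟨hlow t ht.le, hup t ht.le⟩⟩
  · rw [← hfH t ht]
    exact ⟨hup t ht, rfl⟩
  · set f' : ℝ → ℝ := fun t => a t + ∫ s in (0 : ℝ)..t, κ (t - s) * g' s with hf'
    have hg'f : ∀ t ≥ 0, g' t = H (f' t) := fun t ht => (hg'.2 t ht).2
    have h1 := huniq f' ⟨hacont.add (hκ.continuousOn_conv hg'.1), fun t ht => (hg'.2 t ht).1,
      fun t ht => by
        simp only [hf']
        congr 1
        refine intervalIntegral.integral_congr fun s hs => ?_
        rw [uIcc_of_le ht] at hs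
        simp only [hg'f s hs.1, hf']⟩
    intro t ht
    rw [hg'f t ht, h1 t ht]
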